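/- Let p be an odd prime, let u ∈ ℚ_p be a p-adic unit that is not a square in ℚ_p, and set v := -u if p ≡ 1 (mod 4) and v := -1 if p ≡ 3 (mod 4). Let A := diag(1, −v, p) ∈ M₃(ℚ_p) be the Gram matrix of the definite form Q_+(x) = x₀² − v·x₁² + p·x₂², and let SO(3,ℚ_p) := { L ∈ M₃(ℚ_p) | Lᵀ·A·L = A and det L = 1 }. Then every entry of every L ∈ SO(3,ℚ_p) is a p-adic integer (|L_{ij}|_p ≤ 1 for all i, j), and SO(3,ℚ_p) is a compact subset of M₃(ℚ_p) (with the product topology coming from the p-adic topology on ℚ_p). -/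

import Mathlib

/-- Hensel lifting of square roots of units, for odd `p`. -/
theorem aux_isSquare {p : ℕ} [Fact p.Prime] (hp : p ≠ 2) (t a : ℚ_[p]) (ht : ‖t‖ = 1)
    (ha : ‖a‖ = 1) (h : ‖t ^ 2 - a‖ < 1) : IsSquare a := by
  set T : ℤ_[p] := ⟨t, ht.le⟩ with hT
  set B : ℤ_[p] := ⟨a, ha.le⟩ with hB
  have h2 : ‖(2 : ℤ_[p])‖ = 1 := by
    have := (PadicInt.norm_natCast_eq_one_iff (p := p) (n := 2)).2
      ((Nat.coprime_primes Fact.out Nat.prime_two).2 hp)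
    exact_mod_cast this
  have hTn : ‖T‖ = 1 := ht
  have e1 : (Polynomial.X ^ 2 - Polynomial.C B : Polynomial ℤ_[p]).aeval T = T ^ 2 - B := by
    simp
  have e2 : (Polynomial.X ^ 2 - Polynomial.C B : Polynomial ℤ_[p]).derivative.aeval T = 2 * T := by
    simp
    left; norm_num
  have e3 : ‖T ^ 2 - B‖ < 1 := by
    rw [PadicInt.norm_def]; push_cast; exact h
  obtain ⟨z, hz, -⟩ := hensels_lemma (p := p)
    (F := (Polynomial.X ^ 2 - Polynomial.C B : Polynomial ℤ_[p])) (a := T) (by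
      rw [e1, e2, norm_mul, h2, hTn]; simpa using e3)
  refine ⟨(z : ℚ_[p]), ?_⟩
  have hz' : z ^ 2 - B = 0 := by simpa using hz
  have h3 : B = z * z := by linear_combination -hz'
  have h4 : (B : ℚ_[p]) = ((z * z : ℤ_[p]) : ℚ_[p]) := by rw [h3]
  rw [PadicInt.coe_mul] at h4
  exact h4

theorem aux_neg_one {p : ℕ} [Fact p.Prime] (hp : p ≠ 2) :
    IsSquare (-1 : ℚ_[p]) ↔ p % 4 = 1 := by
  have hodd : p % 2 = 1 := (Nat.Prime.eq_two_or_odd (Fact.out : p.Prime)).resolve_left hp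
  have key : IsSquare (-1 : ZMod p) ↔ p % 4 ≠ 3 := ZMod.exists_sq_eq_neg_one_iff
  constructor
  · rintro ⟨x, hx⟩
    have hx1 : ‖x‖ = 1 := by
      have h := congrArg norm hx
      rw [norm_mul, norm_neg, norm_one] at h
      nlinarith [norm_nonneg x]
    have : IsSquare (-1 : ZMod p) := by
      set X : ℤ_[p] := ⟨x, hx1.le⟩
      refine ⟨PadicInt.toZMod X, ?_⟩
      have hX : (-1 : ℤ_[p]) = X * X := by
        apply Subtype.ext
        push_cast
        exact hx
      rw [← map_mul, ← hX]; simp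
    have := key.1 this
    omega
  · intro h
    obtain ⟨y, hy⟩ := key.2 (by omega)
    have hd : p ∣ y.val ^ 2 + 1 := by
      rw [← ZMod.natCast_eq_zero_iff]
      push_cast
      rw [ZMod.natCast_zmod_val]
      linear_combination -hy
    have hn : ¬ p ∣ y.val := by
      intro hc
      have h1 := (Nat.dvd_add_right (Dvd.dvd.pow hc two_ne_zero)).1 hd
      exact (Fact.out : p.Prime).one_lt.ne' (Nat.dvd_one.1 h1)
    apply aux_isSquare hp (y.val : ℚ_[p])
    · rw [Padic.norm_natCast_eq_one_iff]
      exact ((Fact.out : p.Prime).coprime_iff_not_dvd).2 hn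
    · simp
    · have := (Padic.norm_natCast_lt_one_iff (p := p)).2 hd
      push_cast at this
      simpa using this

theorem aux_binary {p : ℕ} [Fact p.Prime] (hp : p ≠ 2) (v : ℚ_[p]) (hv : ‖v‖ = 1)
    (hns : ¬ IsSquare v) (x y : ℚ_[p]) :
    ‖x ^ 2 + -v * y ^ 2‖ = (max ‖x‖ ‖y‖) ^ 2 := by
  have hn2 : ‖-v * y ^ 2‖ = ‖y‖ ^ 2 := by simp [hv]
  by_cases h : ‖x‖ = ‖y‖
  · by_cases hy : y = 0
    · subst hy
      simp
    · have hy' : ‖y‖ ≠ 0 := by simpa using hy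
      have ht : ‖x / y‖ = 1 := by rw [norm_div, h, div_self hy']
      have h1 : ¬ ‖(x / y) ^ 2 - v‖ < 1 := fun hc => hns (aux_isSquare hp _ _ ht hv hc)
      have h2 : ‖(x / y) ^ 2 - v‖ ≤ 1 := by
        have := Padic.nonarchimedean ((x / y) ^ 2) (-v)
        rw [← sub_eq_add_neg] at this
        simpa [ht, hv, -norm_div] using this
      have h3 : ‖(x / y) ^ 2 - v‖ = 1 := le_antisymm h2 (not_lt.1 h1)
      have e : x ^ 2 + -v * y ^ 2 = ((x / y) ^ 2 - v) * y ^ 2 := by field_simp; ring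
      rw [e, norm_mul, h3, norm_pow, h]; simp
  · have h' : ‖x ^ 2‖ ≠ ‖-v * y ^ 2‖ := by
      rw [hn2, norm_pow]
      intro hc
      exact h ((sq_eq_sq₀ (norm_nonneg _) (norm_nonneg _)).1 hc)
    rw [Padic.add_eq_max_of_ne h', hn2, norm_pow]
    rcases le_total ‖x‖ ‖y‖ with hle | hle
    · rw [max_eq_right hle, max_eq_right (by gcongr)]
    · rw [max_eq_left hle, max_eq_left (by gcongr)]

theorem aux_parity {p : ℕ} [Fact p.Prime] (w z : ℚ_[p]) (h : ‖w‖ ^ 2 = ‖(p : ℚ_[p]) * z ^ 2‖) :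
    z = 0 := by
  by_contra hz
  have hp0 : (p : ℚ_[p]) ≠ 0 := by exact_mod_cast (Fact.out : p.Prime).ne_zero
  have hw : w ≠ 0 := by
    rintro rfl
    simp [hz] at h
    exact (Fact.out : p.Prime).ne_zero h
  rw [← norm_pow, Padic.norm_eq_zpow_neg_valuation (pow_ne_zero 2 hw),
    Padic.norm_eq_zpow_neg_valuation (mul_ne_zero hp0 (pow_ne_zero 2 hz))] at h
  have hp1 : (1 : ℝ) < p := by exact_mod_cast (Fact.out : p.Prime).one_lt
  have h2 := zpow_right_injective₀ (by linarith) hp1.ne' h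
  rw [Padic.valuation_mul hp0 (pow_ne_zero 2 hz), Padic.valuation_pow, Padic.valuation_pow,
    Padic.valuation_p] at h2
  push_cast at h2
  omega

theorem aux_ternary {p : ℕ} [Fact p.Prime] (hp : p ≠ 2) (v : ℚ_[p]) (hv : ‖v‖ = 1)
    (hns : ¬ IsSquare v) (x y z : ℚ_[p])
    (h : ‖x ^ 2 + -v * y ^ 2 + (p : ℚ_[p]) * z ^ 2‖ ≤ 1) :
    ‖x‖ ≤ 1 ∧ ‖y‖ ≤ 1 ∧ ‖z‖ ≤ 1 := by
  have hb := aux_binary hp v hv hns x y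
  have hmax : max ‖x‖ ‖y‖ ^ 2 ≤ 1 ∧ ‖(p : ℚ_[p]) * z ^ 2‖ ≤ 1 := by
    by_cases he : ‖x ^ 2 + -v * y ^ 2‖ = ‖(p : ℚ_[p]) * z ^ 2‖
    · have hz : z = 0 := by
        rw [hb] at he
        rcases max_choice ‖x‖ ‖y‖ with hm | hm
        · rw [hm] at he; exact aux_parity x z he
        · rw [hm] at he; exact aux_parity y z he
      subst hz
      rw [← hb]
      simpa using h
    · rw [Padic.add_eq_max_of_ne he, hb] at h
      exact max_le_iff.1 h
  obtain ⟨h1, h2⟩ := hmax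
  have h3 : max ‖x‖ ‖y‖ ≤ 1 := by
    have : 0 ≤ max ‖x‖ ‖y‖ := le_max_of_le_left (norm_nonneg _)
    exact (sq_le_one_iff₀ this).1 h1
  refine ⟨(le_max_left _ _).trans h3, (le_max_right _ _).trans h3, ?_⟩
  have hp1 : (1 : ℝ) < p := by exact_mod_cast (Fact.out : p.Prime).one_lt
  have h4 : ‖z‖ ^ 2 ≤ p := by
    rw [norm_mul, Padic.norm_p, norm_pow, inv_mul_le_iff₀ (by linarith)] at h2
    linarith
  have h5 := (Padic.norm_le_pow_iff_norm_lt_pow_add_one z 0).2 (by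
    simp only [zero_add, zpow_one]
    nlinarith [norm_nonneg z])
  simpa using h5

/-- For an odd prime `p`, with `u` a non-square `p`-adic unit and `v = -u` if `p ≡ 1 (mod 4)`,
`v = -1` if `p ≡ 3 (mod 4)`, let `A = diag(1, −v, p)` be the Gram matrix of the definite form
`Q₊`. Every element of `SO(3,ℚ_p) = {L | Lᵀ·A·L = A, det L = 1}` has `p`-adic integer entries,
and `SO(3,ℚ_p)` is a compact subset of `M₃(ℚ_p)`. -/
theorem Padic.SO3_entries_integral_and_compact {p : ℕ} [Fact p.Prime] (hp : p ≠ 2)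
    (u : ℚ_[p]) (hu : ‖u‖ = 1) (hu' : ¬ IsSquare u)
    (v : ℚ_[p]) (hv : v = if p % 4 = 1 then -u else -1)
    (A : Matrix (Fin 3) (Fin 3) ℚ_[p]) (hA : A = Matrix.diagonal ![1, -v, (p : ℚ_[p])]) :
    (∀ L : Matrix (Fin 3) (Fin 3) ℚ_[p],
        L.transpose * A * L = A → L.det = 1 → ∀ i j, ‖L i j‖ ≤ 1) ∧
    IsCompact {L : Matrix (Fin 3) (Fin 3) ℚ_[p] | L.transpose * A * L = A ∧ L.det = 1} := by
  have hvn : ‖v‖ = 1 := by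
    rw [hv]; split_ifs <;> simp [hu]
  have hns : ¬ IsSquare v := by
    rw [hv]
    split_ifs with h
    · intro hc
      have := ((aux_neg_one hp).2 h).mul hc
      simp at this
      exact hu' this
    · exact fun hc => h ((aux_neg_one hp).1 hc)
  have hpn : ‖(p : ℚ_[p])‖ ≤ 1 := Padic.norm_p_lt_one.le
  have main : ∀ L : Matrix (Fin 3) (Fin 3) ℚ_[p],
      L.transpose * A * L = A → L.det = 1 → ∀ i j, ‖L i j‖ ≤ 1 := by
    intro L hL _ i j
    have h := congrFun (congrFun hL j) j
    have hAj : ‖A j j‖ ≤ 1 := by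
      rw [hA]; fin_cases j <;> simp [hvn, hpn, -Padic.norm_p]
    have e : (L.transpose * A * L) j j
        = L 0 j ^ 2 + -v * L 1 j ^ 2 + (p : ℚ_[p]) * L 2 j ^ 2 := by
      rw [hA, Matrix.mul_apply]
      simp only [Matrix.mul_diagonal, Fin.sum_univ_three, Matrix.transpose_apply]
      simp
      ring
    rw [← h, e] at hAj
    obtain ⟨h0, h1, h2⟩ := aux_ternary hp v hvn hns _ _ _ hAj
    fin_cases i
    · exact h0
    · exact h1
    · exact h2
  refine ⟨main, ?_⟩
  have hc : IsCompact (Set.pi Set.univ fun _ : Fin 3 => Set.pi Set.univ fun _ : Fin 3 =>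
      Metric.closedBall (0 : ℚ_[p]) 1) :=
    isCompact_univ_pi fun _ => isCompact_univ_pi fun _ => isCompact_closedBall _ _
  refine IsCompact.of_isClosed_subset hc ?_ ?_
  · refine IsClosed.inter (s₁ := {L : Matrix (Fin 3) (Fin 3) ℚ_[p] | L.transpose * A * L = A})
      (s₂ := {L : Matrix (Fin 3) (Fin 3) ℚ_[p] | L.det = 1}) ?_ ?_
    · exact isClosed_eq (by fun_prop) continuous_const
    · exact isClosed_eq (by fun_prop) continuous_const
  · rintro L ⟨h1, h2⟩ i _ j _
    simpa using main L h1 h2 i j
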